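/- A noetherian ring A is almost Cohen-Macaulay if and only if the localization A_P is almost Cohen-Macaulay for every prime ideal P, if and only if A_Q is almost Cohen-Macaulay for every maximal ideal Q. -/

import Mathlib

open IsLocalRing

/-- The `I`-depth (grade) of an `A`-module `M`: the supremum of lengths of
`M`-regular sequences with entries in `I`. -/
noncomputable def idealDepth {A : Type*} [CommRing A] (I : Ideal A)
    (M : Type*) [AddCommGroup M] [Module A M] : ℕ∞ :=
  sSup {n : ℕ∞ | ∃ rs : List A, (rs.length : ℕ∞) = n ∧ (∀ r ∈ rs, r ∈ I) ∧
    RingTheory.Sequence.IsRegular M rs}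

/-- The depth of a local ring: the depth with respect to its maximal ideal. -/
noncomputable def ringDepth (A : Type*) [CommRing A] [IsLocalRing A] : ℕ∞ :=
  idealDepth (IsLocalRing.maximalIdeal A) A

/-- depth(A_P), the depth of the localization of `A` at the prime `P`. -/
noncomputable def localDepth {A : Type*} [CommRing A] (P : Ideal A) [P.IsPrime] : ℕ∞ :=
  ringDepth (Localization.AtPrime P)

/-- The height of a prime ideal. -/
noncomputable def primeHeight {A : Type*} [CommRing A] (P : Ideal A) [P.IsPrime] : ℕ∞ :=
  Order.height (⟨P, inferInstance⟩ : PrimeSpectrum A)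

/-- A noetherian local ring is almost Cohen-Macaulay if `dim A ≤ 1 + depth A`. -/
def IsAlmostCM (A : Type*) [CommRing A] [IsLocalRing A] : Prop :=
  ringKrullDim A ≤ ((1 + ringDepth A : ℕ∞) : WithBot ℕ∞)

/-- Almost Cohen-Macaulay for a (local) ring presented with an explicit maximal ideal `I`:
`dim R ≤ 1 + depth_I R`. -/
def IsAlmostCMWith (R : Type*) [CommRing R] (I : Ideal R) : Prop :=
  ringKrullDim R ≤ ((1 + idealDepth I R : ℕ∞) : WithBot ℕ∞)

/-- A ring is almost Cohen-Macaulay (Han/Kang) if `depth_P A = depth (A_P)` for all primes. -/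
def IsACM (A : Type*) [CommRing A] : Prop :=
  ∀ (P : Ideal A) [P.IsPrime], idealDepth P A = localDepth P

/-- Serre's condition `(S_k)`: `depth A_P ≥ min (ht P, k)` for all primes `P`. -/
def SerreCond (k : ℕ) (A : Type*) [CommRing A] : Prop :=
  ∀ (P : Ideal A) [P.IsPrime], min (primeHeight P) (k : ℕ∞) ≤ localDepth P

/-- The condition `(C_k)`: `depth A_P ≥ min (ht P, k) - 1` for all primes `P`. -/
def CondC (k : ℕ) (A : Type*) [CommRing A] : Prop :=
  ∀ (P : Ideal A) [P.IsPrime], min (primeHeight P) (k : ℕ∞) ≤ 1 + localDepth P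


open RingTheory.Sequence Pointwise

universe u v

/-- If `I` contains no element regular on `M`, it lies in an associated prime of `M`. -/
lemma exists_isSMulRegular_or_le_associatedPrime {R : Type*} [CommRing R] [IsNoetherianRing R]
    (I : Ideal R) (M : Type*) [AddCommGroup M] [Module R M] [Module.Finite R M] :
    (∃ y ∈ I, IsSMulRegular M y) ∨ ∃ p ∈ associatedPrimes R M, I ≤ p := by
  by_contra! h
  obtain ⟨h₁, h₂⟩ := h
  obtain ⟨p, hp, hIp⟩ := (I.subset_union_prime_finite (associatedPrimes.finite R M)
    (f := id) 0 0 fun _ h _ _ ↦ h.isPrime).1 <| by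
      intro x hx
      simp only [id]
      rw [biUnion_associatedPrimes_eq_zero_divisors]
      have := h₁ x hx
      rw [isSMulRegular_iff_right_eq_zero_of_smul] at this
      push Not at this
      obtain ⟨m, hm, hm'⟩ := this
      exact ⟨m, hm', hm⟩
  exact h₂ p hp hIp

lemma IsSMulRegular.notMem_of_mem_associatedPrimes {R : Type*} [CommRing R] [IsNoetherianRing R]
    {M : Type*} [AddCommGroup M] [Module R M] {y : R} (hy : IsSMulRegular M y) {p : Ideal R}
    (hp : p ∈ associatedPrimes R M) : y ∉ p := by
  intro hyp
  have : y ∈ ⋃ p ∈ associatedPrimes R M, (p : Set R) := Set.mem_biUnion hp hyp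
  rw [biUnion_associatedPrimes_eq_zero_divisors] at this
  obtain ⟨x, hx, h⟩ := this
  exact hx (isSMulRegular_iff_right_eq_zero_of_smul.mp hy x h)

lemma Submodule.ideal_smul_top_quotSMulTop_ne_top {R : Type*} [CommRing R] {M : Type*}
    [AddCommGroup M] [Module R M] {I : Ideal R} {r : R} (hr : r ∈ I)
    (hI : I • (⊤ : Submodule R M) ≠ ⊤) : I • (⊤ : Submodule R (QuotSMulTop r M)) ≠ ⊤ := by
  intro eq
  absurd congrArg (Submodule.comap (Submodule.mkQ _)) eq
  simpa [Submodule.comap_smul_top_of_surjective I _ (Submodule.mkQ_surjective _),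
    Submodule.smul_mono_left ((Ideal.span_singleton_le_iff_mem I).mpr hr),
    ← Submodule.ideal_span_singleton_smul] using hI

open CategoryTheory Abelian in
lemma exists_isRegular_quotSMulTop {R : Type u} [CommRing R] [Small.{v} R] [IsNoetherianRing R]
    {I : Ideal R} {M : Type v} [AddCommGroup M] [Module R M] [Module.Finite R M]
    (hI : I • (⊤ : Submodule R M) ≠ ⊤) {a : R} (ha : a ∈ I) (hreg : IsSMulRegular M a) {n : ℕ}
    (h : ∃ rs : List R, rs.length = n + 1 ∧ (∀ r ∈ rs, r ∈ I) ∧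
      RingTheory.Sequence.IsRegular M rs) :
    ∃ rs : List R, rs.length = n ∧ (∀ r ∈ rs, r ∈ I) ∧
      RingTheory.Sequence.IsRegular (QuotSMulTop a M) rs := by
  have hExt := ((ModuleCat.exists_isRegular_tfae I (n + 1) (ModuleCat.of R M)
    hI.lt_top).out 3 1).mp h
  refine ((ModuleCat.exists_isRegular_tfae I n (ModuleCat.of R (QuotSMulTop a M))
    (Submodule.ideal_smul_top_quotSMulTop_ne_top ha hI).lt_top).out 1 3).mp fun i hi ↦ ?_
  have zero₁ := AddCommGrpCat.isZero_of_iff_subsingleton.mpr (hExt i (by omega))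
  have zero₂ := AddCommGrpCat.isZero_of_iff_subsingleton.mpr (hExt (i + 1) (by omega))
  have hreg' : IsSMulRegular (ModuleCat.of R M) a := hreg
  exact AddCommGrpCat.subsingleton_of_isZero <| ShortComplex.Exact.isZero_of_both_zeros
    ((Ext.covariant_sequence_exact₃' _ hreg'.smulShortComplex_shortExact) i (i + 1) rfl)
    (zero₁.eq_zero_of_src _) (zero₂.eq_zero_of_tgt _)

/-- Regular sequences in `I` of equal length are interchangeable: modulo a regular sequence `rs`
there remains a regular sequence of the complementary length. -/
lemma RingTheory.Sequence.IsRegular.exists_isRegular_quotient {R : Type u} [CommRing R]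
    [Small.{v} R] [IsNoetherianRing R] {I : Ideal R} {M : Type v} [AddCommGroup M] [Module R M]
    [Module.Finite R M] (hI : I • (⊤ : Submodule R M) ≠ ⊤) {rs : List R}
    (hrs : RingTheory.Sequence.IsRegular M rs) (hmem : ∀ r ∈ rs, r ∈ I) {n : ℕ}
    (h : ∃ rs' : List R, rs'.length = rs.length + n ∧ (∀ r ∈ rs', r ∈ I) ∧
      RingTheory.Sequence.IsRegular M rs') :
    ∃ rs' : List R, rs'.length = n ∧ (∀ r ∈ rs', r ∈ I) ∧
      RingTheory.Sequence.IsRegular (M ⧸ (Ideal.ofList rs • ⊤ : Submodule R M)) rs' := by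
  induction rs generalizing M with
  | nil =>
    obtain ⟨rs', hlen, hmem', hreg⟩ := h
    refine ⟨rs', by simpa using hlen, hmem', ?_⟩
    exact (LinearEquiv.isRegular_congr
      (Submodule.quotEquivOfEqBot _ (by rw [Ideal.ofList_nil, Submodule.bot_smul])) rs').mpr hreg
  | cons a rs ih =>
    rw [isRegular_cons_iff] at hrs
    simp only [List.mem_cons, forall_eq_or_imp, List.length_cons] at hmem h
    obtain ⟨rs', hlen, hmem', hreg⟩ := ih
      (Submodule.ideal_smul_top_quotSMulTop_ne_top hmem.1 hI) hrs.2 hmem.2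
      (exists_isRegular_quotSMulTop hI hmem.1 hrs.1
        (by simpa only [add_right_comm] using h))
    exact ⟨rs', hlen, hmem', (LinearEquiv.isRegular_congr
      (Submodule.quotOfListConsSMulTopEquivQuotSMulTopInner M a rs) rs').mpr hreg⟩

/-- If `x` is a regular element of the maximal ideal, then every associated prime `p` of `M` is
contained in an associated prime of `M ⧸ xM` which contains `x`. -/
lemma exists_associatedPrime_quotSMulTop {R : Type*} [CommRing R] [IsNoetherianRing R]
    [IsLocalRing R] {M : Type*} [AddCommGroup M] [Module R M] [Module.Finite R M] {p : Ideal R}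
    (hp : p ∈ associatedPrimes R M) {x : R} (hx : IsSMulRegular M x)
    (hxm : x ∈ maximalIdeal R) :
    ∃ q ∈ associatedPrimes R (QuotSMulTop x M), p ≤ q ∧ x ∈ q := by
  let N : Submodule R M :=
    { carrier := {m | ∀ r ∈ p, r • m = 0}
      add_mem' := fun ha hb r hr ↦ by rw [smul_add, ha r hr, hb r hr, add_zero]
      zero_mem' := fun r _ ↦ smul_zero r
      smul_mem' := fun c m hm r hr ↦ by rw [smul_comm, hm r hr, smul_zero] }
  have hN : N ≠ ⊥ := by
    obtain ⟨hprime, m, hm⟩ := isAssociatedPrime_iff.mp hp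
    refine fun h ↦ hprime.ne_top ?_
    have hmN : m ∈ N := fun r hr ↦ by
      rw [hm] at hr
      simpa [Submodule.mem_colon_singleton] using hr
    rw [h, Submodule.mem_bot] at hmN
    rw [hm, hmN]
    simp
  obtain ⟨m, hmN, hmx⟩ : ∃ m ∈ N, m ∉ x • (⊤ : Submodule R M) := by
    by_contra! h
    refine hN (Submodule.eq_bot_of_le_smul_of_le_jacobson_bot (Ideal.span {x}) N
      (IsNoetherian.noetherian N) (fun m hm ↦ ?_) ?_)
    · obtain ⟨n, -, rfl⟩ := (Submodule.mem_smul_pointwise_iff_exists _ _ _).mp (h m hm)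
      refine Submodule.smul_mem_smul (Ideal.mem_span_singleton_self x) fun r hr ↦ ?_
      refine isSMulRegular_iff_right_eq_zero_of_smul.mp hx _ ?_
      rw [smul_comm]
      exact hm r hr
    · rw [IsLocalRing.jacobson_eq_maximalIdeal _ bot_ne_top, Ideal.span_singleton_le_iff_mem]
      exact hxm
  let y : QuotSMulTop x M := Submodule.Quotient.mk m
  obtain ⟨q, hq, hyq⟩ := exists_le_isAssociatedPrime_of_isNoetherianRing R y
    (by rwa [Ne, Submodule.Quotient.mk_eq_zero])
  refine ⟨q, hq, fun r hr ↦ hyq ?_, hyq ?_⟩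
  · rw [Submodule.mem_colon_singleton, Submodule.mem_bot, ← Submodule.Quotient.mk_smul, hmN r hr,
      Submodule.Quotient.mk_zero]
  · rw [Submodule.mem_colon_singleton, Submodule.mem_bot, ← Submodule.Quotient.mk_smul,
      Submodule.Quotient.mk_eq_zero]
    exact Submodule.smul_mem_pointwise_smul m x ⊤ trivial

/-- Over a noetherian local ring, `ht p + n ≤ ht 𝔪` for every associated prime `p` of `M` and every
`M`-regular sequence of length `n`. -/
lemma height_add_length_le_height_maximalIdeal {R : Type*} [CommRing R] [IsNoetherianRing R]
    [IsLocalRing R] {M : Type*} [AddCommGroup M] [Module R M] [Module.Finite R M] {p : Ideal R}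
    (hp : p ∈ associatedPrimes R M) {rs : List R} (hrs : RingTheory.Sequence.IsRegular M rs)
    (hmem : ∀ r ∈ rs, r ∈ maximalIdeal R) :
    p.height + rs.length ≤ (maximalIdeal R).height := by
  induction rs generalizing M p with
  | nil => simpa using Ideal.height_mono (IsLocalRing.le_maximalIdeal hp.isPrime.ne_top)
  | cons x rs ih =>
    rw [isRegular_cons_iff] at hrs
    simp only [List.mem_cons, forall_eq_or_imp] at hmem
    obtain ⟨q, hq, hpq, hxq⟩ := exists_associatedPrime_quotSMulTop hp hrs.1 hmem.1
    have := hp.isPrime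
    have := hq.isPrime
    have hlt : p < q := lt_of_le_of_ne hpq fun h ↦
      hrs.1.notMem_of_mem_associatedPrimes hp (h ▸ hxq)
    calc p.height + ((x :: rs).length : ℕ∞) = p.height + 1 + rs.length := by
          rw [List.length_cons]; push_cast; ring
      _ ≤ q.height + rs.length := by
          gcongr; exact Ideal.height_add_one_le_of_lt_of_isPrime hlt
      _ ≤ _ := ih hq hrs.2 hmem.2

lemma Ideal.smul_top_ne_top {R : Type*} [CommRing R] {I : Ideal R} (hI : I ≠ ⊤) :
    I • (⊤ : Ideal R) ≠ ⊤ := by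
  rwa [Ideal.smul_eq_mul, Ideal.mul_top]

section idealDepth

variable {R : Type*} [CommRing R]

lemma length_le_idealDepth {I : Ideal R} {rs : List R} (hmem : ∀ r ∈ rs, r ∈ I)
    (hrs : RingTheory.Sequence.IsRegular R rs) : (rs.length : ℕ∞) ≤ idealDepth I R :=
  le_sSup ⟨rs, rfl, hmem, hrs⟩

lemma idealDepth_le_iff {I : Ideal R} {d : ℕ∞} : idealDepth I R ≤ d ↔
    ∀ rs : List R, (∀ r ∈ rs, r ∈ I) → RingTheory.Sequence.IsRegular R rs →
      (rs.length : ℕ∞) ≤ d := by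
  rw [idealDepth, sSup_le_iff]
  exact ⟨fun h rs hmem hrs ↦ h _ ⟨rs, rfl, hmem, hrs⟩,
    fun h _ ⟨rs, hlen, hmem, hrs⟩ ↦ hlen ▸ h rs hmem hrs⟩

lemma idealDepth_mono {I J : Ideal R} (h : I ≤ J) : idealDepth I R ≤ idealDepth J R :=
  idealDepth_le_iff.mpr fun _ hmem hrs ↦ length_le_idealDepth (fun r hr ↦ h (hmem r hr)) hrs

lemma exists_length_eq_idealDepth [Nontrivial R] {I : Ideal R} (h : idealDepth I R ≠ ⊤) :
    ∃ rs : List R, (rs.length : ℕ∞) = idealDepth I R ∧ (∀ r ∈ rs, r ∈ I) ∧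
      RingTheory.Sequence.IsRegular R rs := by
  have : Nonempty {n : ℕ∞ | ∃ rs : List R, (rs.length : ℕ∞) = n ∧ (∀ r ∈ rs, r ∈ I) ∧
      RingTheory.Sequence.IsRegular R rs} := ⟨0, [], by simp, by simp, .nil R R⟩
  exact ENat.sSup_mem_of_nonempty_of_lt_top h.lt_top

/-- A regular sequence in `I` of maximal length has an associated prime of its quotient containing
`I`. -/
lemma exists_associatedPrime_of_length_eq_idealDepth [IsNoetherianRing R] {I : Ideal R}
    (hI : I ≠ ⊤) {rs : List R} (hlen : (rs.length : ℕ∞) = idealDepth I R)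
    (hmem : ∀ r ∈ rs, r ∈ I) (hrs : RingTheory.Sequence.IsRegular R rs) :
    ∃ p ∈ associatedPrimes R (R ⧸ (Ideal.ofList rs • ⊤ : Ideal R)), I ≤ p := by
  refine (exists_isSMulRegular_or_le_associatedPrime I _).resolve_left fun ⟨y, hyI, hy⟩ ↦ ?_
  have hmem' : ∀ r ∈ rs ++ [y], r ∈ I := by
    simpa [or_imp, forall_and] using ⟨hmem, hyI⟩
  have hreg : RingTheory.Sequence.IsRegular R (rs ++ [y]) := by
    refine ⟨(isWeaklyRegular_append_iff R rs [y]).mpr ⟨hrs.1,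
      (isWeaklyRegular_singleton_iff _ y).mpr hy⟩, fun h ↦ hI ?_⟩
    rw [eq_top_iff, h, Ideal.smul_eq_mul, Ideal.mul_top]
    exact Ideal.span_le.mpr hmem'
  have := length_le_idealDepth hmem' hreg
  rw [← hlen] at this
  simp only [List.length_append, List.length_singleton, Nat.cast_le] at this
  omega

end idealDepth

section local_ring

variable {R : Type*} [CommRing R] [IsNoetherianRing R] [IsLocalRing R]

lemma ringDepth_le_height_maximalIdeal : ringDepth R ≤ (maximalIdeal R).height := by
  refine idealDepth_le_iff.mpr fun rs hmem hrs ↦ ?_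
  obtain ⟨p, hp⟩ := associatedPrimes.nonempty R R
  exact le_add_self.trans (height_add_length_le_height_maximalIdeal hp hrs hmem)

lemma ringDepth_ne_top : ringDepth R ≠ ⊤ :=
  (ringDepth_le_height_maximalIdeal.trans_lt (Ideal.height_lt_top Ideal.IsPrime.ne_top')).ne

lemma exists_isRegular_length_eq_ringDepth_sub {rs : List R} (hmem : ∀ r ∈ rs, r ∈ maximalIdeal R)
    (hrs : RingTheory.Sequence.IsRegular R rs) : ∃ rs' : List R,
      (rs.length + rs'.length : ℕ∞) = ringDepth R ∧ (∀ r ∈ rs', r ∈ maximalIdeal R) ∧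
      RingTheory.Sequence.IsRegular (R ⧸ (Ideal.ofList rs • ⊤ : Ideal R)) rs' := by
  obtain ⟨ss, hlen, hss, hreg⟩ := exists_length_eq_idealDepth (R := R) ringDepth_ne_top
  have hle := length_le_idealDepth hmem hrs
  rw [← hlen, Nat.cast_le] at hle
  obtain ⟨rs', hlen', hmem', hreg'⟩ := hrs.exists_isRegular_quotient
    (Ideal.smul_top_ne_top Ideal.IsPrime.ne_top') hmem (n := ss.length - rs.length)
    ⟨ss, by omega, hss, hreg⟩
  refine ⟨rs', ?_, hmem', hreg'⟩
  rw [ringDepth, ← hlen, hlen', ← Nat.cast_add, Nat.add_sub_cancel' hle]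

/-- In an almost Cohen-Macaulay local ring, `ht P ≤ 1 + depth_P R`. -/
lemma height_le_one_add_idealDepth (h : (maximalIdeal R).height ≤ 1 + ringDepth R)
    (P : Ideal R) [P.IsPrime] : P.height ≤ 1 + idealDepth P R := by
  by_cases htop : idealDepth P R = ⊤
  · simp [htop]
  have hP : P ≤ maximalIdeal R := IsLocalRing.le_maximalIdeal Ideal.IsPrime.ne_top'
  obtain ⟨rs, hlen, hmem, hrs⟩ := exists_length_eq_idealDepth htop
  obtain ⟨Q, hQ, hPQ⟩ := exists_associatedPrime_of_length_eq_idealDepth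
    Ideal.IsPrime.ne_top' hlen hmem hrs
  obtain ⟨rs', hlen', hmem', hrs'⟩ :=
    exists_isRegular_length_eq_ringDepth_sub (fun r hr ↦ hP (hmem r hr)) hrs
  have key := (height_add_length_le_height_maximalIdeal hQ hrs' hmem').trans h
  rw [← hlen', ← add_assoc, ENat.add_le_add_iff_right (ENat.natCast_ne_top _), hlen] at key
  exact (Ideal.height_mono hPQ).trans key

lemma ringDepth_eq_length_iff {rs : List R} (hmem : ∀ r ∈ rs, r ∈ maximalIdeal R)
    (hrs : RingTheory.Sequence.IsRegular R rs) : ringDepth R = rs.length ↔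
      maximalIdeal R ∈ associatedPrimes R (R ⧸ (Ideal.ofList rs • ⊤ : Ideal R)) := by
  refine ⟨fun h ↦ ?_, fun h ↦ ?_⟩
  · obtain ⟨p, hp, hle⟩ := exists_associatedPrime_of_length_eq_idealDepth
      Ideal.IsPrime.ne_top' h.symm hmem hrs
    rwa [(IsLocalRing.maximalIdeal.isMaximal R).eq_of_le hp.isPrime.ne_top hle]
  · obtain ⟨_ | ⟨y, rs'⟩, hlen, hmem', hrs'⟩ := exists_isRegular_length_eq_ringDepth_sub hmem hrs
    · simpa using hlen.symm
    · exact absurd (hmem' y List.mem_cons_self)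
        (((isRegular_cons_iff _ _ _).mp hrs').1.notMem_of_mem_associatedPrimes h)

end local_ring

lemma RingEquiv.ringDepth_le {R S : Type*} [CommRing R] [CommRing S] [IsLocalRing R]
    [IsLocalRing S] (e : R ≃+* S) : ringDepth R ≤ ringDepth S := by
  refine idealDepth_le_iff.mpr fun rs hmem hrs ↦ ?_
  rw [← List.length_map (f := e)]
  refine length_le_idealDepth ?_ ((AddEquiv.isRegular_congr (e := e.toAddEquiv) ?_).mp hrs)
  · simpa using hmem
  · exact List.forall₂_map_right_iff.mpr (List.forall₂_same.mpr fun r _ x ↦ by simp)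

section localization

variable {A : Type*} [CommRing A]

lemma idealDepth_le_localDepth (P : Ideal A) [P.IsPrime] : idealDepth P A ≤ localDepth P := by
  refine idealDepth_le_iff.mpr fun rs hmem hrs ↦ ?_
  rw [← List.length_map (f := algebraMap A (Localization.AtPrime P))]
  refine length_le_idealDepth ?_
    (hrs.1.isRegular_of_isLocalization_of_mem (Localization.AtPrime P) P hmem)
  intro r hr
  obtain ⟨a, ha, rfl⟩ := List.mem_map.mp hr
  exact (IsLocalization.AtPrime.to_map_mem_maximal_iff _ P a).mpr (hmem a ha)

lemma isAlmostCM_localization_iff (P : Ideal A) [P.IsPrime] :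
    IsAlmostCM (Localization.AtPrime P) ↔ P.height ≤ 1 + localDepth P := by
  rw [IsAlmostCM, IsLocalization.AtPrime.ringKrullDim_eq_height P, localDepth]
  exact WithBot.coe_le_coe

variable [IsNoetherianRing A]

lemma maximalIdeal_mem_associatedPrimes_localization_iff (Q : Ideal A) [Q.IsPrime] (rs : List A) :
    maximalIdeal (Localization.AtPrime Q) ∈ associatedPrimes (Localization.AtPrime Q)
      (Localization.AtPrime Q ⧸ (Ideal.ofList (rs.map (algebraMap A (Localization.AtPrime Q))) • ⊤ :
        Ideal (Localization.AtPrime Q))) ↔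
    Q ∈ associatedPrimes A (A ⧸ (Ideal.ofList rs • ⊤ : Ideal A)) := by
  have h : Submodule.localized' (Localization.AtPrime Q) Q.primeCompl
      (Algebra.linearMap A (Localization.AtPrime Q)) (Ideal.ofList rs • ⊤ : Ideal A) =
      Ideal.ofList (rs.map (algebraMap A (Localization.AtPrime Q))) • ⊤ := by
    rw [Ideal.localized'_eq_map, Ideal.smul_eq_mul, Ideal.smul_eq_mul, Ideal.mul_top,
      Ideal.mul_top, Ideal.map_ofList]
  rw [← h, ← Module.associatedPrimes.preimage_comap_associatedPrimes_eq_associatedPrimes_of_isLocalizedModule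
    Q.primeCompl (Localization.AtPrime Q) (Submodule.toLocalizedQuotient' (Localization.AtPrime Q)
      Q.primeCompl (Algebra.linearMap A (Localization.AtPrime Q)) (Ideal.ofList rs • ⊤ : Ideal A)),
    Set.mem_preimage]
  have := Localization.AtPrime.under_maximalIdeal (I := Q)
  rw [Ideal.under] at this
  rw [this]

lemma localDepth_eq_length_iff {Q : Ideal A} [Q.IsPrime] {rs : List A} (hmem : ∀ r ∈ rs, r ∈ Q)
    (hrs : RingTheory.Sequence.IsRegular A rs) : localDepth Q = rs.length ↔
      Q ∈ associatedPrimes A (A ⧸ (Ideal.ofList rs • ⊤ : Ideal A)) := by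
  rw [← maximalIdeal_mem_associatedPrimes_localization_iff, ← ringDepth_eq_length_iff,
    List.length_map, localDepth]
  · intro r hr
    obtain ⟨a, ha, rfl⟩ := List.mem_map.mp hr
    exact (IsLocalization.AtPrime.to_map_mem_maximal_iff _ Q a).mpr (hmem a ha)
  · exact hrs.1.isRegular_of_isLocalization_of_mem (Localization.AtPrime Q) Q hmem

lemma localDepth_le_height (P : Ideal A) [P.IsPrime] : localDepth P ≤ P.height := by
  have h := ringDepth_le_height_maximalIdeal (R := Localization.AtPrime P)
  rwa [← IsLocalization.height_under P.primeCompl, Localization.AtPrime.under_maximalIdeal] at h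

lemma localDepth_ne_top (P : Ideal A) [P.IsPrime] : localDepth P ≠ ⊤ :=
  ringDepth_ne_top

lemma height_le_one_add_localDepth_of_le {P Q : Ideal A} [P.IsPrime] [Q.IsPrime] (hPQ : P ≤ Q)
    (hQ : Q.height ≤ 1 + localDepth Q) : P.height ≤ 1 + localDepth P := by
  obtain ⟨p, hp, rfl⟩ : ∃ (p : Ideal (Localization.AtPrime Q)) (_ : p.IsPrime),
      P = p.comap (algebraMap A (Localization.AtPrime Q)) :=
    ⟨P.map (algebraMap A (Localization.AtPrime Q)),
      Ideal.isPrime_map_of_isLocalizationAtPrime Q hPQ,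
      (IsLocalization.under_map_of_isPrime_disjoint Q.primeCompl _ ‹_›
        (Set.disjoint_compl_left_iff_subset.mpr hPQ)).symm⟩
  have hm : (maximalIdeal (Localization.AtPrime Q)).height = Q.height := by
    rw [← IsLocalization.height_under Q.primeCompl, Localization.AtPrime.under_maximalIdeal]
  have hp' := height_le_one_add_idealDepth (hm.trans_le hQ) p
  rw [← IsLocalization.height_under Q.primeCompl] at hp'
  refine hp'.trans ?_
  gcongr
  exact (idealDepth_le_localDepth p).trans (RingEquiv.ringDepth_le
    (IsLocalization.localizationLocalizationAtPrimeIsoLocalization Q.primeCompl p).symm.toRingEquiv)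

/-- If `depth A_P` equals `depth_P A` for all `P`, then `ht P ≤ 1 + depth A_P`. -/
lemma IsACM.height_le_one_add_localDepth (h : IsACM A) (P : Ideal A) [P.IsPrime] :
    P.height ≤ 1 + localDepth P := by
  classical
  have : Nontrivial A := nontrivial_of_ne (1 : A) 0 fun h10 ↦
    (P.ne_top_iff_one.mp Ideal.IsPrime.ne_top') (h10 ▸ P.zero_mem)
  by_contra! hlt
  obtain ⟨rs, hlen, hmem, hrs⟩ := exists_length_eq_idealDepth (I := P)
    (h P ▸ localDepth_ne_top P)
  have hfin := associatedPrimes.finite A (A ⧸ (Ideal.ofList rs • ⊤ : Ideal A))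
  obtain ⟨y, hyP, hy⟩ : ∃ y ∈ P, ∀ q ∈ associatedPrimes A (A ⧸ (Ideal.ofList rs • ⊤ : Ideal A)),
      y ∈ q → P ≤ q := by
    by_contra! hy
    obtain ⟨q, ⟨-, hq⟩, hPq⟩ := (P.subset_union_prime_finite
      (hfin.subset (Set.sep_subset _ fun q ↦ ¬ P ≤ q)) (f := id) 0 0
      fun _ h _ _ ↦ h.1.isPrime).1 fun y hyP ↦ by
        obtain ⟨q, hq, hyq, hPq⟩ := hy y hyP
        exact Set.mem_biUnion (x := q) ⟨hq, hPq⟩ hyq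
    exact hq hPq
  obtain ⟨Q, hQ, hQP⟩ := Ideal.exists_minimalPrimes_le
    (I := Ideal.span ((y :: rs).toFinset : Set A)) (J := P)
    (Ideal.span_le.mpr fun r hr ↦ by
      have hr' : r = y ∨ r ∈ rs := by simpa using hr
      exact hr'.elim (fun h ↦ h ▸ hyP) (hmem r))
  have := hQ.1.1
  have hsub : ∀ r ∈ y :: rs, r ∈ Q := fun r hr ↦
    hQ.1.2 (Ideal.subset_span (by simpa using hr))
  simp only [List.mem_cons, forall_eq_or_imp] at hsub
  have hheight : Q.height ≤ 1 + localDepth P := calc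
    Q.height ≤ ((y :: rs).toFinset.card : ℕ∞) :=
      Ideal.height_le_card_of_mem_minimalPrimes_span_finset hQ
    _ ≤ ((y :: rs).length : ℕ∞) := by exact_mod_cast List.toFinset_card_le _
    _ = 1 + localDepth P := by
      rw [← h P, ← hlen, List.length_cons, add_comm]; push_cast; rfl
  have hPQ : ¬ P ≤ Q := fun hPQ ↦ (hheight.trans_lt hlt).not_ge (Ideal.height_mono hPQ)
  refine hPQ (hy Q ((localDepth_eq_length_iff hsub.2 hrs).mp (le_antisymm ?_ ?_)) hsub.1)
  · rw [← h Q, hlen]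
    exact idealDepth_mono hQP
  · exact h Q ▸ length_le_idealDepth hsub.2 hrs

lemma isACM_of_height_le_one_add_localDepth
    (h : ∀ (P : Ideal A) [P.IsPrime], P.height ≤ 1 + localDepth P) : IsACM A := by
  intro P _
  have : Nontrivial A := nontrivial_of_ne (1 : A) 0 fun h10 ↦
    (P.ne_top_iff_one.mp Ideal.IsPrime.ne_top') (h10 ▸ P.zero_mem)
  refine (idealDepth_le_localDepth P).antisymm (le_of_not_gt fun hlt ↦ ?_)
  obtain ⟨rs, hlen, hmem, hrs⟩ := exists_length_eq_idealDepth hlt.ne_top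
  obtain ⟨Q, hQ, hPQ⟩ := exists_associatedPrime_of_length_eq_idealDepth
    Ideal.IsPrime.ne_top' hlen hmem hrs
  have := hQ.isPrime
  have hQdepth := (localDepth_eq_length_iff (fun r hr ↦ hPQ (hmem r hr)) hrs).mpr hQ
  rw [hlen] at hQdepth
  have hne : P < Q := lt_of_le_of_ne hPQ <| by
    rintro rfl
    exact hlt.ne' hQdepth
  have key : 1 + localDepth P ≤ 1 + localDepth Q := calc
    1 + localDepth P ≤ P.height + 1 := by
      rw [add_comm]; gcongr; exact localDepth_le_height P
    _ ≤ Q.height := Ideal.height_add_one_le_of_lt_of_isPrime hne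
    _ ≤ 1 + localDepth Q := h Q
  rw [hQdepth, ENat.add_le_add_iff_left (by simp)] at key
  exact hlt.not_ge key

end localization

theorem isACM_iff_localizations {A : Type*} [CommRing A] [IsNoetherianRing A] :
    (IsACM A ↔ ∀ (P : Ideal A) [P.IsPrime], IsAlmostCM (Localization.AtPrime P)) ∧
      ((∀ (P : Ideal A) [P.IsPrime], IsAlmostCM (Localization.AtPrime P)) ↔
        ∀ (Q : Ideal A) [Q.IsMaximal], IsAlmostCM (Localization.AtPrime Q)) := by
  simp only [isAlmostCM_localization_iff]
  refine ⟨⟨IsACM.height_le_one_add_localDepth, isACM_of_height_le_one_add_localDepth⟩,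
    fun h Q _ ↦ h Q, fun h P _ ↦ ?_⟩
  obtain ⟨Q, _, hPQ⟩ := P.exists_le_maximal Ideal.IsPrime.ne_top'
  exact height_le_one_add_localDepth_of_le hPQ (h Q)
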